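/- Let N be a network on n nodes with γ protocols and nonnegative cost function w. If P is a feasible path from a node S to a node D that reaches a maximum stack height strictly greater than γ·n², then there exists a feasible path P' from S to D with strictly fewer hops than P, with cost w(P') ≤ w(P), and whose maximum stack height is strictly smaller than the maximum stack height of P. -/

import Mathlib

/-- An adaptation function over a protocol set `A`: a conversion `(a→b)`,
an encapsulation `(a→ab)`, or a decapsulation `(a→ab)‾`. -/
inductive AdaptFun (A : Type) where
  | conv : A → A → AdaptFun A
  | encap : A → A → AdaptFun A
  | decap : A → A → AdaptFun A
deriving DecidableEq

/-- The partial action of an adaptation function on a protocol stack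
(a list whose head is the top of the stack). -/
def AdaptFun.apply {A : Type} [DecidableEq A] : AdaptFun A → List A → Option (List A)
  | .conv a b, x :: T => if x = a then some (b :: T) else none
  | .encap a b, x :: T => if x = a then some (b :: a :: T) else none
  | .decap a b, y :: x :: T => if y = b ∧ x = a then some (a :: T) else none
  | _, _ => none

/-- A network: a symmetric directed graph on node set `V`, adaptation functions `F U`
available at each node, receivable protocols `In U`, and a nonnegative cost function `w`. -/
structure Network (A V : Type) where
  E : V → V → Prop
  symm : ∀ u v, E u v ↔ E v u
  F : V → Set (AdaptFun A)
  In : V → Set A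
  w : V → AdaptFun A → V → ℝ
  w_nonneg : ∀ u f v, 0 ≤ w u f v

/-- A path `S f₀ U₁ f₁ … U_ℓ f_ℓ D`: `len` is `ℓ`, `nodes i` is `U_i`
(with `nodes 0 = S` and `nodes (ℓ+1) = D`), and `funs i` is `f_i`. -/
structure NetPath (A V : Type) where
  len : ℕ
  nodes : ℕ → V
  funs : ℕ → AdaptFun A

/-- The stack sequence of a path: `H₀ = [x]` where `f₀` is the conversion `(x→x)`,
and `H_i = f_i (H_{i-1})`. -/
def NetPath.stack {A V : Type} [DecidableEq A] (P : NetPath A V) : ℕ → Option (List A)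
  | 0 =>
    match P.funs 0 with
    | .conv a b => if a = b then some [a] else none
    | _ => none
  | i + 1 => (P.stack i).bind (P.funs (i + 1)).apply

/-- Feasibility of a path from `S` to `D` in the network `N`. -/
def Feasible {A V : Type} [DecidableEq A] (N : Network A V) (S D : V)
    (P : NetPath A V) : Prop :=
  P.nodes 0 = S ∧ P.nodes (P.len + 1) = D ∧
  (∀ i ≤ P.len, N.E (P.nodes i) (P.nodes (i + 1))) ∧
  (∀ i, 1 ≤ i → i ≤ P.len → P.funs i ∈ N.F (P.nodes i)) ∧
  (∃ x, P.funs 0 = .conv x x) ∧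
  (∀ i ≤ P.len, (P.stack i).isSome) ∧
  (∃ y ∈ N.In D, P.stack P.len = some [y])

/-- The cost of a path: `w(P) = Σ_{i=0}^{ℓ} w(U_i, f_i, U_{i+1})`. -/
def pathCost {A V : Type} (N : Network A V) (P : NetPath A V) : ℝ :=
  ∑ i ∈ Finset.range (P.len + 1), N.w (P.nodes i) (P.funs i) (P.nodes (i + 1))

/-- The maximum stack height `max_i |H_i|` reached along a path. -/
def NetPath.maxHeight {A V : Type} [DecidableEq A] (P : NetPath A V) : ℕ :=
  (Finset.range (P.len + 1)).sup fun i => ((P.stack i).map List.length).getD 0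

section AdaptFun

variable {A : Type} [DecidableEq A]

theorem AdaptFun.apply_ne_nil {f : AdaptFun A} {H H' : List A} (h : f.apply H = some H') :
    H' ≠ [] := by
  unfold AdaptFun.apply at h
  split at h <;> grind

theorem AdaptFun.length_apply_le {f : AdaptFun A} {H H' : List A} (h : f.apply H = some H') :
    H'.length ≤ H.length + 1 ∧ H.length ≤ H'.length + 1 := by
  unfold AdaptFun.apply at h
  split at h <;> grind

theorem AdaptFun.suffix_of_apply_of_length_lt {f : AdaptFun A} {H H' : List A}
    (h : f.apply H = some H') (hlt : H.length < H'.length) : H <:+ H' := by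
  unfold AdaptFun.apply at h
  split at h <;> (try split_ifs at h) <;>
    simp only [Option.some.injEq, reduceCtorEq] at h <;> subst h <;> simp_all

/-- A suffix strictly below the top of the stack survives as long as the height allows. -/
theorem AdaptFun.suffix_of_apply {f : AdaptFun A} {H H' B : List A}
    (h : f.apply H = some H') (hB : B <:+ H) (hlt : B.length < H.length)
    (hle : B.length ≤ H'.length) : B <:+ H' := by
  unfold AdaptFun.apply at h
  split at h <;> (try split_ifs at h) <;>
    simp only [Option.some.injEq, reduceCtorEq] at h <;> subst h <;>
    rw [List.suffix_cons_iff] at hB <;> rcases hB with rfl | hB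
  all_goals first
    | exact absurd hlt (lt_irrefl _)
    | grind [List.suffix_cons_iff]

/-- The action of an adaptation function that stays above the stack `B` does not depend
on `B`. -/
theorem AdaptFun.apply_append {f : AdaptFun A} {T B H' : List A}
    (h : f.apply (T ++ B) = some H') (hT : T ≠ []) (hlt : B.length < H'.length) :
    ∃ T', T' ≠ [] ∧ H' = T' ++ B ∧ ∀ C, f.apply (T ++ C) = some (T' ++ C) := by
  obtain ⟨x, T, rfl⟩ := List.exists_cons_of_ne_nil hT
  cases f with
  | conv a b =>
    simp only [AdaptFun.apply, List.cons_append] at h ⊢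
    split_ifs at h with hx
    exact ⟨b :: T, by simp, by simpa using h.symm, by simp [hx]⟩
  | encap a b =>
    simp only [AdaptFun.apply, List.cons_append] at h ⊢
    split_ifs at h with hx
    exact ⟨b :: a :: T, by simp, by simpa using h.symm, by simp [hx]⟩
  | decap a b =>
    cases T with
    | nil =>
      cases B with
      | nil => simp [AdaptFun.apply] at h
      | cons y B =>
        simp only [AdaptFun.apply, List.cons_append, List.nil_append] at h
        split_ifs at h with hx
        simp only [Option.some.injEq] at h
        subst h
        simp at hlt
    | cons y T =>
      simp only [AdaptFun.apply, List.cons_append] at h ⊢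
      split_ifs at h with hx
      exact ⟨a :: T, by simp, by simpa using h.symm, by simp [hx]⟩

end AdaptFun

section Levels

/-- The last visit to level `k` before time `m`. -/
theorem exists_last_visit {u : ℕ → ℕ} {k m : ℕ} (h0 : u 0 ≤ k) (hm : k ≤ u m)
    (hu : ∀ i < m, u (i + 1) ≤ u i + 1) :
    ∃ a ≤ m, u a = k ∧ ∀ i, a < i → i ≤ m → k < u i := by
  induction m with
  | zero => exact ⟨0, le_rfl, by omega, by omega⟩
  | succ m ih =>
    rcases hm.eq_or_lt with hm | hm
    · exact ⟨m + 1, le_rfl, hm.symm, by omega⟩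
    · obtain ⟨a, ha, hak, hgt⟩ := ih (by have := hu m (by omega); omega)
        fun i hi => hu i (by omega)
      refine ⟨a, by omega, hak, fun i hai him => ?_⟩
      rcases him.eq_or_lt with rfl | him
      · exact hm
      · exact hgt i hai (by omega)

/-- The first visit to level `k` from time `m` on. -/
theorem exists_first_visit {u : ℕ → ℕ} {k m l : ℕ} (hml : m ≤ l) (hl : u l ≤ k) (hm : k ≤ u m)
    (hu : ∀ i < l, u i ≤ u (i + 1) + 1) :
    ∃ b, m ≤ b ∧ b ≤ l ∧ u b = k ∧ ∀ i, m ≤ i → i < b → k < u i := by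
  obtain ⟨a, ha, hak, hgt⟩ := exists_last_visit (u := fun i => u (l - i)) (k := k) (m := l - m)
    (by simpa using hl) (by simpa [Nat.sub_sub_self hml] using hm) fun i hi => by
      have := hu (l - (i + 1)) (by omega)
      rwa [show l - (i + 1) + 1 = l - i by omega] at this
  refine ⟨l - a, by omega, by omega, hak, fun i hmi hi => ?_⟩
  have := hgt (l - i) (by omega) (by omega)
  rwa [show l - (l - i) = i by omega] at this

end Levels

namespace NetPath

variable {A V : Type}

/-- The path obtained by deleting the steps `a + 1, …, c`. -/
def cut (P : NetPath A V) (a c : ℕ) : NetPath A V where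
  len := P.len - (c - a)
  nodes i := if i ≤ a then P.nodes i else P.nodes (i + (c - a))
  funs i := if i ≤ a then P.funs i else P.funs (i + (c - a))

/-- The conditions for feasibility that do not involve the stacks. -/
def IsRoute (N : Network A V) (S D : V) (P : NetPath A V) : Prop :=
  P.nodes 0 = S ∧ P.nodes (P.len + 1) = D ∧
  (∀ i ≤ P.len, N.E (P.nodes i) (P.nodes (i + 1))) ∧
  (∀ i, 1 ≤ i → i ≤ P.len → P.funs i ∈ N.F (P.nodes i)) ∧
  ∃ x, P.funs 0 = .conv x x

variable {N : Network A V} {S D : V} {P : NetPath A V} {a c : ℕ}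

theorem cut_nodes_succ_of_le (hac : a ≤ c) (h : P.nodes (a + 1) = P.nodes (c + 1)) {i : ℕ}
    (hi : i ≤ a) : (P.cut a c).nodes (i + 1) = P.nodes (i + 1) := by
  rcases hi.eq_or_lt with rfl | hi
  · simp only [cut, show ¬ i + 1 ≤ i by omega, if_false, h]
    congr 1
    omega
  · simp only [cut, Nat.succ_le_of_lt hi, if_true]

theorem cut_nodes_succ_of_lt {i : ℕ} (hi : a < i) :
    (P.cut a c).nodes (i + 1) = P.nodes (i + (c - a) + 1) := by
  simp only [cut, show ¬ i + 1 ≤ a by omega, if_false]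
  congr 1
  omega

theorem IsRoute.cut (hP : P.IsRoute N S D) (hac : a ≤ c) (hc : c ≤ P.len)
    (h : P.nodes (a + 1) = P.nodes (c + 1)) : (P.cut a c).IsRoute N S D := by
  obtain ⟨h0, hD, hE, hF, hf⟩ := hP
  refine ⟨by simpa [NetPath.cut] using h0, ?_, fun i hi => ?_, fun i h1 hi => ?_,
    by simpa [NetPath.cut] using hf⟩
  · rcases le_or_gt (P.cut a c).len a with hl | hl
    · rw [cut_nodes_succ_of_le hac h hl, ← hD]
      simp only [NetPath.cut] at hl ⊢
      rw [show P.len - (c - a) = a by omega, h, show c = P.len by omega]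
    · rw [cut_nodes_succ_of_lt hl, ← hD]
      simp only [NetPath.cut]
      congr 1
      omega
  · have hl : (P.cut a c).len = P.len - (c - a) := rfl
    rcases le_or_gt i a with hia | hia
    · rw [cut_nodes_succ_of_le hac h hia]
      simpa [NetPath.cut, hia] using hE i (by omega)
    · rw [cut_nodes_succ_of_lt hia]
      simpa [NetPath.cut, hia.not_ge] using hE (i + (c - a)) (by omega)
  · have hl : (P.cut a c).len = P.len - (c - a) := rfl
    rcases le_or_gt i a with hia | hia
    · simpa [NetPath.cut, hia] using hF i h1 (by omega)
    · simpa [NetPath.cut, hia.not_ge] using hF (i + (c - a)) (by omega) (by omega)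

theorem pathCost_cut_le (hac : a ≤ c) (hc : c ≤ P.len)
    (h : P.nodes (a + 1) = P.nodes (c + 1)) : pathCost N (P.cut a c) ≤ pathCost N P := by
  set g : ℕ → ℝ := fun i => N.w (P.nodes i) (P.funs i) (P.nodes (i + 1)) with hg
  set φ : ℕ → ℕ := fun i => if i ≤ a then i else i + (c - a) with hφ
  have hinj : Function.Injective φ := by
    intro i j hij
    simp only [hφ] at hij
    split_ifs at hij <;> omega
  calc pathCost N (P.cut a c)
      = ∑ i ∈ Finset.range (P.len - (c - a) + 1), g (φ i) := by
        refine Finset.sum_congr rfl fun i _ => ?_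
        rcases le_or_gt i a with hia | hia
        · rw [cut_nodes_succ_of_le hac h hia]
          simp [cut, hg, hφ, hia]
        · rw [cut_nodes_succ_of_lt hia]
          simp [cut, hg, hφ, hia.not_ge]
    _ = ∑ i ∈ (Finset.range (P.len - (c - a) + 1)).image φ, g i :=
        (Finset.sum_image hinj.injOn).symm
    _ ≤ pathCost N P := by
        refine Finset.sum_le_sum_of_subset_of_nonneg (fun j hj => ?_)
          fun i _ _ => N.w_nonneg _ _ _
        simp only [Finset.mem_image, Finset.mem_range, hφ] at hj ⊢
        obtain ⟨i, hi, rfl⟩ := hj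
        split_ifs <;> omega

variable [DecidableEq A]

theorem stack_zero_congr {P Q : NetPath A V} (h : Q.funs 0 = P.funs 0) :
    Q.stack 0 = P.stack 0 := by
  simp only [stack, h]

theorem maxHeight_le_iff {M : ℕ} :
    P.maxHeight ≤ M ↔ ∀ i ≤ P.len, ((P.stack i).map List.length).getD 0 ≤ M := by
  simp [maxHeight, Finset.sup_le_iff]

theorem exists_height_eq_maxHeight (P : NetPath A V) :
    ∃ m ≤ P.len, ((P.stack m).map List.length).getD 0 = P.maxHeight := by
  obtain ⟨m, hm, h⟩ := Finset.exists_mem_eq_sup (Finset.range (P.len + 1)) (by simp)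
    fun i => ((P.stack i).map List.length).getD 0
  exact ⟨m, by simpa [Nat.lt_succ_iff] using hm, h.symm⟩

/-- Replacing the steps `a + 1, …, b` by the inner steps `a' + 1, …, b'`. -/
def splice (P : NetPath A V) (a a' b' b : ℕ) : NetPath A V := (P.cut b' b).cut a a'

variable {H : ℕ → List A} {a a' b' b : ℕ} {x : A} {B B' : List A}

theorem splice_stack_before (hst : ∀ i ≤ P.len, P.stack i = some (H i))
    (haa : a ≤ a') (hab : a' ≤ b') (hb : b' ≤ P.len) :
    ∀ i ≤ a, (P.splice a a' b' b).stack i = some (H i) := by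
  intro i
  induction i with
  | zero =>
    intro _
    rw [← hst 0 (by omega)]
    exact stack_zero_congr (by simp [splice, cut])
  | succ i ih =>
    intro hi
    rw [← hst _ (by omega), stack, stack, ih (by omega), hst _ (by omega)]
    simp [splice, cut, hi, show i + 1 ≤ b' by omega]

theorem splice_stack_inner (hst : ∀ i ≤ P.len, P.stack i = some (H i))
    (haa : a ≤ a') (hab : a' ≤ b') (hb : b' ≤ P.len)
    (ha : H a = x :: B) (ha' : H a' = x :: B')
    (hgt : ∀ i, a' ≤ i → i ≤ b' → B'.length < (H i).length) (t : ℕ) (ht : t ≤ b' - a') :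
    ∃ T, H (a' + t) = T ++ B' ∧ T ≠ [] ∧
      (P.splice a a' b' b).stack (a + t) = some (T ++ B) := by
  induction t with
  | zero =>
    exact ⟨[x], ha', by simp, by
      simpa [ha] using splice_stack_before (b := b) hst haa hab hb a le_rfl⟩
  | succ t ih =>
    obtain ⟨T, hT, hne, hs⟩ := ih (by omega)
    have hstep := hst (a' + t + 1) (by omega)
    rw [stack, hst _ (by omega), Option.bind_some, hT] at hstep
    obtain ⟨T', hne', hT', happ⟩ := AdaptFun.apply_append hstep hne
      (hgt _ (by omega) (by omega))
    refine ⟨T', hT', hne', ?_⟩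
    rw [← add_assoc, stack, hs, Option.bind_some, ← happ]
    congr 1
    simp only [splice, cut]
    rw [if_neg (by omega), if_pos (by omega)]
    congr 1
    omega

theorem splice_stack_after (hst : ∀ i ≤ P.len, P.stack i = some (H i))
    (haa : a ≤ a') (hab : a' ≤ b') (hbb : b' ≤ b)
    (hs : (P.splice a a' b' b).stack (a + (b' - a')) = some (H b)) (t : ℕ)
    (ht : b + t ≤ P.len) :
    (P.splice a a' b' b).stack (a + (b' - a') + t) = some (H (b + t)) := by
  induction t with
  | zero => exact hs
  | succ t ih =>
    rw [← hst _ ht, ← add_assoc, ← add_assoc, stack, stack, ih (by omega), hst _ (by omega)]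
    congr 2
    simp only [splice, cut]
    rw [if_neg (by omega), if_neg (by omega)]
    congr 1
    omega

end NetPath

section Shorten

variable {A V : Type} [DecidableEq A] {N : Network A V} {S D : V} {P : NetPath A V}

theorem Feasible.splice (hP : Feasible N S D P) {H : ℕ → List A} {a a' b' b : ℕ} {x : A}
    {B B' : List A} (hst : ∀ i ≤ P.len, P.stack i = some (H i))
    (haa : a < a') (hab : a' ≤ b') (hbb : b' < b) (hb : b ≤ P.len)
    (hna : P.nodes (a + 1) = P.nodes (a' + 1)) (hnb : P.nodes (b + 1) = P.nodes (b' + 1))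
    (ha : H a = x :: B) (ha' : H a' = x :: B') (hHb : H b = H a) (hHb' : H b' = H a')
    (hgt : ∀ i, a' ≤ i → i ≤ b' → B'.length < (H i).length)
    (hBB : B.length ≤ B'.length) :
    Feasible N S D (P.splice a a' b' b) ∧ (P.splice a a' b' b).len < P.len ∧
      pathCost N (P.splice a a' b' b) ≤ pathCost N P ∧
      (P.splice a a' b' b).maxHeight ≤ P.maxHeight := by
  obtain ⟨h0, hD, hE, hF, hf, -, y, hy, hPy⟩ := hP
  set Q := P.splice a a' b' b with hQ
  have hlen : Q.len = P.len - (b - b') - (a' - a) := rfl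
  have hlen1 : (P.cut b' b).len = P.len - (b - b') := rfl
  have hna1 : (P.cut b' b).nodes (a + 1) = (P.cut b' b).nodes (a' + 1) := by
    rw [NetPath.cut_nodes_succ_of_le hbb.le hnb.symm (by omega),
      NetPath.cut_nodes_succ_of_le hbb.le hnb.symm hab, hna]
  have hroute : Q.IsRoute N S D :=
    (NetPath.IsRoute.cut ⟨h0, hD, hE, hF, hf⟩ hbb.le hb hnb.symm).cut haa.le (by omega) hna1
  have hcost : pathCost N Q ≤ pathCost N P :=
    (NetPath.pathCost_cut_le haa.le (by omega) hna1).trans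
      (NetPath.pathCost_cut_le hbb.le hb hnb.symm)
  have hbefore := NetPath.splice_stack_before (b := b) hst haa.le hab (by omega)
  have hinner := NetPath.splice_stack_inner (b := b) hst haa.le hab (by omega) ha ha' hgt
  have hmid : Q.stack (a + (b' - a')) = some (H b) := by
    obtain ⟨T, hT, -, hs⟩ := hinner (b' - a') le_rfl
    rw [show a' + (b' - a') = b' by omega, hHb', ha', ← List.singleton_append,
      List.append_left_inj] at hT
    rw [hs, hHb, ha, ← hT, List.singleton_append]
  have hafter := NetPath.splice_stack_after hst haa.le hab hbb.le hmid
  have hheight : ∀ i ≤ P.len, (H i).length ≤ P.maxHeight := fun i hi => by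
    simpa [hst i hi] using NetPath.maxHeight_le_iff.1 le_rfl i hi
  have hstack : ∀ i ≤ Q.len, ∃ L, Q.stack i = some L ∧ L.length ≤ P.maxHeight := by
    intro i hi
    rcases le_or_gt i a with h | h
    · exact ⟨_, hbefore i h, hheight i (by omega)⟩
    rcases le_or_gt i (a + (b' - a')) with h' | h'
    · obtain ⟨T, hT, -, hs⟩ := hinner (i - a) (by omega)
      rw [show a + (i - a) = i by omega] at hs
      refine ⟨_, hs, ?_⟩
      have := hheight (a' + (i - a)) (by omega)
      rw [hT, List.length_append] at this
      rw [List.length_append]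
      omega
    · have hs := hafter (i - (a + (b' - a'))) (by omega)
      rw [show a + (b' - a') + (i - (a + (b' - a'))) = i by omega] at hs
      exact ⟨_, hs, hheight _ (by omega)⟩
  obtain ⟨g0, gD, gE, gF, gf⟩ := hroute
  refine ⟨⟨g0, gD, gE, gF, gf, fun i hi => ?_, y, hy, ?_⟩, by omega, hcost, ?_⟩
  · obtain ⟨L, hL, -⟩ := hstack i hi
    simp [hL]
  · have hs := hafter (P.len - b) (by omega)
    rw [show a + (b' - a') + (P.len - b) = Q.len by omega, show b + (P.len - b) = P.len by omega,
      ← hst _ le_rfl, hPy] at hs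
    exact hs
  · refine NetPath.maxHeight_le_iff.2 fun i hi => ?_
    obtain ⟨L, hL, hle⟩ := hstack i hi
    simpa [hL] using hle

/-- The stack is the same at the two ends of an excursion above its height. -/
theorem NetPath.eq_of_excursion {H : ℕ → List A}
    (hst : ∀ i ≤ P.len, P.stack i = some (H i)) {a b : ℕ} (hab : a + 1 < b) (hb : b ≤ P.len)
    (hgt : ∀ i, a < i → i < b → (H a).length < (H i).length)
    (heq : (H b).length = (H a).length) : H b = H a := by
  have hstep : ∀ i < P.len, (P.funs (i + 1)).apply (H i) = some (H (i + 1)) := fun i hi => by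
    have := hst (i + 1) hi
    rwa [stack, hst i hi.le] at this
  have hsuf : ∀ i, a < i → i ≤ b → H a <:+ H i := by
    intro i hai
    induction i, hai using Nat.le_induction with
    | base =>
      intro _
      exact AdaptFun.suffix_of_apply_of_length_lt (hstep a (by omega))
        (hgt _ (by omega) (by omega))
    | succ i hai ih =>
      intro hib
      refine AdaptFun.suffix_of_apply (hstep i (by omega)) (ih (by omega))
        (hgt i hai (by omega)) ?_
      rcases hib.eq_or_lt with rfl | hib
      · exact heq.ge
      · exact (hgt _ (by omega) hib).le
  exact ((hsuf b (by omega) le_rfl).eq_of_length heq.symm).symm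

/-- A feasible path with a high stack has a strictly shorter feasible path that is neither
more expensive nor higher. -/
theorem Feasible.exists_shorter [Fintype A] [Fintype V] (hP : Feasible N S D P)
    (hhigh : Fintype.card A * Fintype.card V ^ 2 < P.maxHeight) :
    ∃ Q : NetPath A V, Feasible N S D Q ∧ Q.len < P.len ∧
      pathCost N Q ≤ pathCost N P ∧ Q.maxHeight ≤ P.maxHeight := by
  have ⟨_, _, _, _, ⟨x₀, hx₀⟩, hsome, y, _, hPy⟩ := hP
  set H : ℕ → List A := fun i => (P.stack i).getD [] with hH
  have hst : ∀ i ≤ P.len, P.stack i = some (H i) := fun i hi => by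
    obtain ⟨L, hL⟩ := Option.isSome_iff_exists.1 (hsome i hi)
    simp [hH, hL]
  have hstep : ∀ i < P.len, (P.funs (i + 1)).apply (H i) = some (H (i + 1)) := fun i hi => by
    have := hst (i + 1) hi
    rwa [NetPath.stack, hst i hi.le] at this
  have hH0 : (H 0).length = 1 := by simp [hH, NetPath.stack, hx₀]
  have hHl : (H P.len).length = 1 := by simp [hH, hPy]
  obtain ⟨m, hm, hmM⟩ := P.exists_height_eq_maxHeight
  rw [hst m hm, Option.map_some, Option.getD_some] at hmM
  have hvisit : ∀ k : Fin P.maxHeight, ∃ a b, a ≤ m ∧ m ≤ b ∧ b ≤ P.len ∧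
      (H a).length = k + 1 ∧ (H b).length = k + 1 ∧
      (∀ i, a < i → i ≤ m → k + 1 < (H i).length) ∧
      ∀ i, m ≤ i → i < b → k + 1 < (H i).length := by
    intro k
    obtain ⟨a, ham, hak, hga⟩ := exists_last_visit (u := fun i => (H i).length)
      (k := (k : ℕ) + 1) (m := m) (by simp [hH0]) (by simp only [hmM]; omega)
      fun i hi => (AdaptFun.length_apply_le (hstep i (by omega))).1
    obtain ⟨b, hmb, hbl, hbk, hgb⟩ := exists_first_visit (u := fun i => (H i).length)
      (k := (k : ℕ) + 1) hm (by simp [hHl]) (by simp only [hmM]; omega)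
      fun i hi => (AdaptFun.length_apply_le (hstep i hi)).2
    exact ⟨a, b, ham, hmb, hbl, hak, hbk, hga, hgb⟩
  choose a b ham hmb hbl hak hbk hga hgb using hvisit
  have heq : ∀ k, H (b k) = H (a k) := by
    intro k
    rcases (ham k).eq_or_lt with h | h
    · rcases (hmb k).eq_or_lt with h' | h'
      · rw [← h', h]
      · have := hgb k m le_rfl h'
        rw [← h, hak k] at this
        omega
    · have hmk := hga k m h le_rfl
      have h' : m < b k := lt_of_le_of_ne (hmb k) fun h' => by
        rw [h', hbk k] at hmk
        omega
      refine NetPath.eq_of_excursion hst (by omega) (hbl k) (fun i h1 h2 => ?_)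
        (by rw [hak, hbk])
      rw [hak]
      rcases le_total i m with him | him
      · exact hga k i h1 him
      · exact hgb k i him h2
  have htop : ∀ k, ∃ x B, H (a k) = x :: B := fun k =>
    List.exists_cons_of_ne_nil fun h => by simpa [h] using hak k
  choose x B hxB using htop
  have hB : ∀ k, (B k).length = k := fun k => by simpa [hxB k] using hak k
  obtain ⟨j, k, hjk, hφ⟩ := Fintype.exists_ne_map_eq_of_card_lt
    (fun k : Fin P.maxHeight => (P.nodes (a k + 1), P.nodes (b k + 1), x k)) (by
      simp only [Fintype.card_prod, Fintype.card_fin]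
      convert hhigh using 1
      ring)
  wlog hlt : j < k generalizing j k
  · exact this k j hjk.symm hφ.symm (lt_of_le_of_ne (not_lt.1 hlt) hjk.symm)
  simp only [Prod.mk.injEq] at hφ
  obtain ⟨hna, hnb, hx⟩ := hφ
  have hltv : (j : ℕ) < k := hlt
  have haa : a j < a k := by
    by_contra! h
    have h1 := hak j
    rcases h.eq_or_lt with h | h
    · have h2 := hak k
      rw [h] at h2
      omega
    · have := hga k _ h (ham j)
      omega
  have hbb : b k < b j := by
    by_contra! h
    have h1 := hbk j
    rcases h.eq_or_lt with h | h
    · have h2 := hbk k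
      rw [← h] at h2
      omega
    · have := hgb k _ (hmb j) h
      omega
  refine ⟨_, hP.splice hst haa ((ham k).trans (hmb k)) hbb (hbl j) hna hnb (hxB j)
    (by rw [hxB k, hx]) (heq j) (heq k) (fun i h1 h2 => ?_) (by rw [hB, hB]; omega)⟩
  rw [hB]
  rcases h1.eq_or_lt with rfl | h1
  · rw [hak]
    omega
  rcases h2.eq_or_lt with rfl | h2
  · rw [hbk]
    omega
  rcases le_total i m with him | him
  · have := hga k i h1 him
    omega
  · have := hgb k i him h2
    omega

theorem Feasible.exists_low [Fintype A] [Fintype V] (hP : Feasible N S D P) :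
    ∃ Q : NetPath A V, Feasible N S D Q ∧ Q.len ≤ P.len ∧
      pathCost N Q ≤ pathCost N P ∧
      Q.maxHeight ≤ Fintype.card A * Fintype.card V ^ 2 := by
  induction hl : P.len using Nat.strong_induction_on generalizing P with
  | _ l ih =>
    subst hl
    rcases le_or_gt P.maxHeight (Fintype.card A * Fintype.card V ^ 2) with h | h
    · exact ⟨P, hP, le_rfl, le_rfl, h⟩
    · obtain ⟨Q, hQ, hlen, hcost, -⟩ := hP.exists_shorter h
      obtain ⟨R, hR, hlen', hcost', hlow⟩ := ih _ hlen hQ rfl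
      exact ⟨R, hR, hlen'.trans hlen.le, hcost'.trans hcost, hlow⟩

end Shorten

/-- If a feasible path `P` from `S` to `D` reaches a maximum stack height strictly greater
than `γ·n²`, then there is a feasible path `P'` from `S` to `D` with strictly fewer hops,
cost at most `w(P)`, and strictly smaller maximum stack height. -/
theorem feasible_path_high_stack_shorten
    {A V : Type} [DecidableEq A] [Fintype A] [Fintype V]
    (γ n : ℕ) (hγ : Fintype.card A = γ) (hn : Fintype.card V = n)
    (N : Network A V) (S D : V) (P : NetPath A V)
    (hP : Feasible N S D P) (hhigh : γ * n ^ 2 < P.maxHeight) :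
    ∃ P' : NetPath A V, Feasible N S D P' ∧
      P'.len + 1 < P.len + 1 ∧
      pathCost N P' ≤ pathCost N P ∧
      P'.maxHeight < P.maxHeight := by
  subst hγ hn
  obtain ⟨Q, hQ, hlen, hcost, -⟩ := hP.exists_shorter hhigh
  obtain ⟨R, hR, hlen', hcost', hlow⟩ := hQ.exists_low
  exact ⟨R, hR, by omega, hcost'.trans hcost, hlow.trans_lt hhigh⟩
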